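/- arXiv:math/0612778 — 2 statements merged into one kernel-verified Lean document; each statement's English description precedes it below -/
import Mathlib

section
/- For every real number q, with r = 1 − q, and every integer t ≥ 2: ∑_{i=3}^{t} i·C(t, i−3)·q^{t−i+3}·r^{i−3} = t·r + 3 − ((t+1)·t·(t−1)/2)·q²·r^{t−2} − (t+2)·t·q·r^{t−1} − (t+3)·r^{t}, where C denotes the binomial coefficient and the sum is over integers i with 3 ≤ i ≤ t. -/
/-- The expectation of `k + c` for a binomial variable `k` with parameters `n` and `r`. -/
theorem sum_add_mul_choose_mul_pow {R : Type*} [CommRing R] (r c : R) (n : ℕ) :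
    ∑ k ∈ Finset.range (n + 1), ((k : R) + c) * (n.choose k : R) * (1 - r) ^ (n - k) * r ^ k
      = n * r + c := by
  have h_mean := congrArg (Polynomial.eval r) (bernsteinPolynomial.sum_smul R n)
  have h_total := congrArg (Polynomial.eval r) (bernsteinPolynomial.sum R n)
  simp only [Polynomial.eval_finsetSum, bernsteinPolynomial, nsmul_eq_mul, Polynomial.eval_mul,
    Polynomial.eval_natCast, Polynomial.eval_pow, Polynomial.eval_X, Polynomial.eval_sub,
    Polynomial.eval_one] at h_mean h_total
  replace h_total := congrArg (c * ·) h_total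
  simp only [Finset.mul_sum, mul_one] at h_total
  refine Eq.trans ?_ (congrArg₂ (· + ·) h_mean h_total)
  simp only [← Finset.sum_add_distrib]
  exact Finset.sum_congr rfl fun k _ => by ring

theorem stmt_6 (q r : ℝ) (hr : r = 1 - q) (t : ℕ) (ht : 2 ≤ t) :
    ∑ i ∈ Finset.Icc 3 t,
        (i : ℝ) * (Nat.choose t (i - 3) : ℝ) * q ^ (t - i + 3) * r ^ (i - 3)
      = (t : ℝ) * r + 3
        - (((t : ℝ) + 1) * (t : ℝ) * ((t : ℝ) - 1) / 2) * q ^ 2 * r ^ (t - 2)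
        - ((t : ℝ) + 2) * (t : ℝ) * q * r ^ (t - 1)
        - ((t : ℝ) + 3) * r ^ t := by
  obtain ⟨s, rfl⟩ := Nat.exists_eq_add_of_le' ht
  obtain rfl : q = 1 - r := by linarith
  have h_shift : ∑ i ∈ Finset.Icc 3 (s + 2), (i : ℝ) * (Nat.choose (s + 2) (i - 3) : ℝ) *
        (1 - r) ^ (s + 2 - i + 3) * r ^ (i - 3)
      = ∑ k ∈ Finset.range s, ((k : ℝ) + 3) * (Nat.choose (s + 2) k : ℝ) *
        (1 - r) ^ (s + 2 - k) * r ^ k := by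
    rw [← Finset.Ico_add_one_right_eq_Icc, Finset.sum_Ico_eq_sum_range]
    refine Finset.sum_congr (by congr 1) fun k hk => ?_
    have hk' := Finset.mem_range.mp hk
    rw [show 3 + k - 3 = k by omega, show s + 2 - (3 + k) + 3 = s + 2 - k by omega]
    push_cast
    ring
  have h_choose : ((s + 2).choose s : ℝ) = ((s : ℝ) + 2) * (s + 1) / 2 := by
    rw [Nat.choose_symm_add, Nat.cast_choose_two]
    push_cast
    ring
  have h_full := sum_add_mul_choose_mul_pow r 3 (s + 2)
  rw [Finset.sum_range_succ, Finset.sum_range_succ, Finset.sum_range_succ, Nat.choose_self,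
    Nat.choose_succ_self_right, h_choose, show s + 2 - s = 2 by omega,
    show s + 2 - (s + 1) = 1 by omega, Nat.sub_self] at h_full
  rw [h_shift, Nat.add_sub_cancel, show s + 2 - 1 = s + 1 by omega]
  push_cast at h_full ⊢
  linear_combination h_full
end

section
/- Let q, r, s be real numbers with s > 0, and set D = √(q² + 4s(1+2s)), ρ₁ = (q + D)/(2(1+2s)), ρ₂ = (q − D)/(2(1+2s)), a₁ = (q + D)(r + 2s)/(2(1+2s)·D), a₂ = −(q − D)(r + 2s)/(2(1+2s)·D). Let p : ℕ → ℝ satisfy p(0) = 0, p(1) = 0 and, for all d ≥ 2, (1+2s)·p(d) = (r+2s)·δ_{d,2} + q·p(d−1) + s·p(d−2), where δ_{d,2} = 1 if d = 2 and 0 otherwise. Then for all i ≥ 0, p(i+2) = a₁·ρ₁^{i} + a₂·ρ₂^{i}. -/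
theorem stmt_13 (q r s : ℝ) (hs : 0 < s)
    (D ρ₁ ρ₂ a₁ a₂ : ℝ)
    (hD : D = Real.sqrt (q ^ 2 + 4 * s * (1 + 2 * s)))
    (hρ₁ : ρ₁ = (q + D) / (2 * (1 + 2 * s)))
    (hρ₂ : ρ₂ = (q - D) / (2 * (1 + 2 * s)))
    (ha₁ : a₁ = (q + D) * (r + 2 * s) / (2 * (1 + 2 * s) * D))
    (ha₂ : a₂ = -((q - D) * (r + 2 * s) / (2 * (1 + 2 * s) * D)))
    (p : ℕ → ℝ)
    (h0 : p 0 = 0) (h1 : p 1 = 0)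
    (hrec : ∀ d, 2 ≤ d →
      (1 + 2 * s) * p d =
        (r + 2 * s) * (if d = 2 then 1 else 0) + q * p (d - 1) + s * p (d - 2)) :
    ∀ i : ℕ, p (i + 2) = a₁ * ρ₁ ^ i + a₂ * ρ₂ ^ i := by
  have hM : 0 < 1 + 2 * s := by linarith
  have hdisc : 0 < q ^ 2 + 4 * s * (1 + 2 * s) := by positivity
  have hD0 : D ≠ 0 := hD ▸ (Real.sqrt_pos.2 hdisc).ne'
  have hDsq : D ^ 2 = q ^ 2 + 4 * s * (1 + 2 * s) := hD ▸ Real.sq_sqrt hdisc.le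
  have hroot₁ : (1 + 2 * s) * ρ₁ ^ 2 = q * ρ₁ + s := by
    rw [hρ₁]
    field_simp
    linear_combination hDsq
  have hroot₂ : (1 + 2 * s) * ρ₂ ^ 2 = q * ρ₂ + s := by
    rw [hρ₂]
    field_simp
    linear_combination hDsq
  have hp2 : (1 + 2 * s) * p 2 = r + 2 * s := by simpa [h0, h1] using hrec 2 le_rfl
  have hp3 : (1 + 2 * s) * p 3 = q * p 2 := by simpa [h1] using hrec 3 (by norm_num)
  have hstep (i : ℕ) : (1 + 2 * s) * p (i + 4) = q * p (i + 3) + s * p (i + 2) := by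
    simpa using hrec (i + 4) (by omega)
  have hinit : p 2 = a₁ + a₂ := by
    apply mul_left_cancel₀ hM.ne'
    rw [hp2, ha₁, ha₂]
    field_simp
    ring
  have hnext : p 3 = a₁ * ρ₁ + a₂ * ρ₂ := by
    apply mul_left_cancel₀ hM.ne'
    rw [hp3, hinit, ha₁, ha₂, hρ₁, hρ₂]
    field_simp
    ring
  intro i
  induction i using Nat.twoStepInduction with
  | zero => simpa using hinit
  | one => simpa using hnext
  | more i ih₁ ih₂ =>
    apply mul_left_cancel₀ hM.ne'
    linear_combination hstep i + q * ih₂ + s * ih₁ -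
      a₁ * ρ₁ ^ i * hroot₁ - a₂ * ρ₂ ^ i * hroot₂
end
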